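/- Let X* be the capacity-achieving input of the amplitude-constrained AWGN channel and M_A = sup_y f_{X*+Z}(y). Then exp(-C(A) - h(Z)) ≤ M_A ≤ exp(-C(A) - h(Z) + 1), where h(Z) = (1/2)log(2πe). In particular 1/(√(2πe) + 2A) ≤ M_A ≤ e/√(2πe + 4A²). -/

import Mathlib

open Real MeasureTheory

noncomputable def stdNormalPdf (t : ℝ) : ℝ := (Real.sqrt (2 * π))⁻¹ * Real.exp (-t ^ 2 / 2)

/-- Output density of the AWGN channel under input distribution `Q`. -/
noncomputable def outDen (Q : Measure ℝ) (y : ℝ) : ℝ := ∫ x, stdNormalPdf (y - x) ∂Q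

/-- Mutual information `I(X; X+Z)` for input distribution `Q` on the AWGN channel. -/
noncomputable def awgnMI (Q : Measure ℝ) : ℝ :=
  ∫ x, (∫ y : ℝ, stdNormalPdf (y - x) * Real.log (stdNormalPdf (y - x) / outDen Q y)) ∂Q

open ProbabilityTheory

lemma gaussianPDFReal_zero_one_eq_stdNormalPdf (t : ℝ) :
    gaussianPDFReal 0 1 t = stdNormalPdf t := by
  simp [gaussianPDFReal, stdNormalPdf]

lemma stdNormalPdf_pos (t : ℝ) : 0 < stdNormalPdf t := by
  unfold stdNormalPdf; positivity

@[fun_prop]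
lemma continuous_stdNormalPdf : Continuous stdNormalPdf := by
  unfold stdNormalPdf; fun_prop

lemma stdNormalPdf_le (t : ℝ) : stdNormalPdf t ≤ (√(2 * π))⁻¹ := by
  unfold stdNormalPdf
  refine mul_le_of_le_one_right (by positivity) (exp_le_one_iff.2 ?_)
  nlinarith [sq_nonneg t]

lemma log_stdNormalPdf (t : ℝ) : log (stdNormalPdf t) = -log √(2 * π) - t ^ 2 / 2 := by
  unfold stdNormalPdf
  rw [log_mul (by positivity) (by positivity), log_inv, log_exp]
  ring

lemma log_sqrt_two_pi_nonneg : 0 ≤ log √(2 * π) := by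
  apply log_nonneg
  rw [one_le_sqrt]
  nlinarith [pi_gt_three]

lemma stdNormalPdf_neg (t : ℝ) : stdNormalPdf (-t) = stdNormalPdf t := by
  simp [stdNormalPdf]

lemma integrable_sq_gaussianReal : Integrable (fun z : ℝ => z ^ 2) (gaussianReal 0 1) := by
  have := (memLp_id_gaussianReal (μ := 0) (v := 1) 2).integrable_sq
  simpa using this

lemma integral_sq_gaussianReal : ∫ z, z ^ 2 ∂(gaussianReal 0 1) = 1 := by
  have h := variance_eq_sub (memLp_id_gaussianReal (μ := 0) (v := 1) 2)
  rw [variance_id_gaussianReal] at h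
  simpa using h.symm

lemma integrable_id_gaussianReal : Integrable (fun z : ℝ => z) (gaussianReal 0 1) := by
  have := (memLp_id_gaussianReal (μ := 0) (v := 1) 1).integrable (by simp)
  exact this

lemma integral_stdNormalPdf_sub_mul (u : ℝ → ℝ) (x : ℝ) :
    ∫ y, stdNormalPdf (y - x) * u y = ∫ z, u (x + z) ∂(gaussianReal 0 1) := by
  rw [integral_gaussianReal_eq_integral_smul one_ne_zero,
    ← integral_sub_right_eq_self (fun z => gaussianPDFReal 0 1 z • u (x + z)) x]
  simp [gaussianPDFReal_zero_one_eq_stdNormalPdf]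

lemma lintegral_gaussianReal_eq {u : ℝ → ENNReal} (hu : Measurable u) :
    ∫⁻ z, u z ∂(gaussianReal 0 1) = ∫⁻ z, ENNReal.ofReal (stdNormalPdf z) * u z := by
  rw [gaussianReal_of_var_ne_zero _ one_ne_zero,
    lintegral_withDensity_eq_lintegral_mul _ (measurable_gaussianPDF 0 1) hu]
  simp [gaussianPDF, gaussianPDFReal_zero_one_eq_stdNormalPdf]

lemma lintegral_gaussianReal_add {u : ℝ → ENNReal} (hu : Measurable u) (x : ℝ) :
    ∫⁻ z, u (x + z) ∂(gaussianReal 0 1) =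
      ∫⁻ y, ENNReal.ofReal (stdNormalPdf (y - x)) * u y := by
  rw [lintegral_gaussianReal_eq (by fun_prop), ← lintegral_sub_right_eq_self _ x]
  simp

/-- If a positive function has mean at most one, its logarithm has nonpositive mean. -/
lemma integral_log_nonpos_of_lintegral_le_one {α : Type*} [MeasurableSpace α] {μ : Measure α}
    [IsProbabilityMeasure μ] {r : α → ℝ} (hr : Measurable r) (hpos : ∀ x, 0 < r x)
    (hle : ∫⁻ x, ENNReal.ofReal (r x) ∂μ ≤ 1) (hlog : Integrable (fun x => log (r x)) μ) :
    ∫ x, log (r x) ∂μ ≤ 0 := by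
  have h_int : Integrable r μ := by
    refine (lintegral_ofReal_ne_top_iff_integrable hr.aestronglyMeasurable
      (ae_of_all _ fun x => (hpos x).le)).1 (ne_top_of_le_ne_top ENNReal.one_ne_top hle)
  have h1 : ∫ x, r x ∂μ ≤ 1 := by
    rw [integral_eq_lintegral_of_nonneg_ae (ae_of_all _ fun x => (hpos x).le)
      hr.aestronglyMeasurable]
    exact ENNReal.toReal_le_of_le_ofReal zero_le_one (by simpa using hle)
  calc ∫ x, log (r x) ∂μ ≤ ∫ x, (r x - 1) ∂μ :=
        integral_mono hlog (h_int.sub (integrable_const _)) fun x => log_le_sub_one_of_pos (hpos x)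
    _ = ∫ x, r x ∂μ - 1 := by rw [integral_sub h_int (integrable_const _)]; simp
    _ ≤ 0 := by linarith

lemma integrable_comp_add_gaussianReal {u : ℝ → ℝ} (hu : Measurable u) {K : ℝ}
    (hK : ∀ y, |u y| ≤ K + y ^ 2) (x : ℝ) :
    Integrable (fun z => u (x + z)) (gaussianReal 0 1) := by
  refine Integrable.mono' (g := fun z => (K + 2 * x ^ 2) + 2 * z ^ 2)
    ((integrable_const _).add (integrable_sq_gaussianReal.const_mul 2))
    (by exact (hu.comp (measurable_const_add x)).aestronglyMeasurable)
    (ae_of_all _ fun z => ?_)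
  rw [norm_eq_abs]
  nlinarith [hK (x + z), sq_nonneg (x - z)]

lemma integrable_comp_add_prod_gaussianReal {P : Measure ℝ} [IsProbabilityMeasure P] {A : ℝ}
    (hP : ∀ᵐ x ∂P, x ∈ Set.Icc (-A) A) {u : ℝ → ℝ} (hu : Measurable u) {K : ℝ}
    (hK : ∀ y, |u y| ≤ K + y ^ 2) :
    Integrable (fun p : ℝ × ℝ => u (p.1 + p.2)) (P.prod (gaussianReal 0 1)) := by
  refine Integrable.mono' (g := fun p => (K + 2 * A ^ 2) + 2 * p.2 ^ 2)
    ((integrable_const _).add ((integrable_sq_gaussianReal.comp_snd P).const_mul 2))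
    (hu.comp measurable_add).aestronglyMeasurable ?_
  have : ∀ᵐ p ∂(P.prod (gaussianReal 0 1)), p.1 ∈ Set.Icc (-A) A :=
    Measure.quasiMeasurePreserving_fst.ae hP
  filter_upwards [this] with p hp
  rw [norm_eq_abs]
  nlinarith [hK (p.1 + p.2), sq_nonneg (p.1 - p.2), hp.1, hp.2]

section OutputDensity

variable {A : ℝ} {Q : Measure ℝ} [IsProbabilityMeasure Q]

lemma integrable_stdNormalPdf_sub (y : ℝ) : Integrable (fun x => stdNormalPdf (y - x)) Q := by
  refine Integrable.mono' (integrable_const (√(2 * π))⁻¹) (by fun_prop) (ae_of_all _ fun x => ?_)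
  rw [norm_of_nonneg (stdNormalPdf_pos _).le]
  exact stdNormalPdf_le _

lemma outDen_le (y : ℝ) : outDen Q y ≤ (√(2 * π))⁻¹ := by
  have := integral_mono (μ := Q) (integrable_stdNormalPdf_sub y) (integrable_const _)
    fun x => stdNormalPdf_le (y - x)
  simpa [outDen] using this

lemma le_outDen (hQ : ∀ᵐ x ∂Q, x ∈ Set.Icc (-A) A) (y : ℝ) :
    (√(2 * π))⁻¹ * exp (-(y ^ 2 + A ^ 2)) ≤ outDen Q y := by
  have := integral_mono_ae (μ := Q) (integrable_const ((√(2 * π))⁻¹ * exp (-(y ^ 2 + A ^ 2))))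
    (integrable_stdNormalPdf_sub y) ?_
  · simpa [outDen] using this
  filter_upwards [hQ] with x hx
  unfold stdNormalPdf
  gcongr
  nlinarith [sq_nonneg (y + x), hx.1, hx.2]

lemma outDen_pos (hQ : ∀ᵐ x ∂Q, x ∈ Set.Icc (-A) A) (y : ℝ) : 0 < outDen Q y :=
  lt_of_lt_of_le (by positivity) (le_outDen hQ y)

@[fun_prop]
lemma continuous_outDen : Continuous (outDen Q) := by
  refine continuous_of_dominated (bound := fun _ => (√(2 * π))⁻¹) (fun y => by fun_prop)
    (fun y => ae_of_all _ fun x => ?_) (integrable_const _) (ae_of_all _ fun x => by fun_prop)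
  rw [norm_of_nonneg (stdNormalPdf_pos _).le]
  exact stdNormalPdf_le _

lemma abs_log_outDen_le (hQ : ∀ᵐ x ∂Q, x ∈ Set.Icc (-A) A) (y : ℝ) :
    |log (outDen Q y)| ≤ (log √(2 * π) + A ^ 2) + y ^ 2 := by
  have h0 := log_sqrt_two_pi_nonneg
  have h1 := log_le_log (outDen_pos hQ y) (outDen_le y)
  have h2 := log_le_log (by positivity) (le_outDen hQ y)
  rw [log_mul (by positivity) (by positivity), log_exp, log_inv] at h2
  rw [log_inv] at h1
  rw [abs_le]
  constructor <;> nlinarith [sq_nonneg y, sq_nonneg A]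

/-- `outDen Q` is the density of the sum of independent `Q` and standard normal variables. -/
lemma lintegral_prod_gaussianReal_add {u : ℝ → ENNReal} (hu : Measurable u) :
    ∫⁻ p, u (p.1 + p.2) ∂(Q.prod (gaussianReal 0 1)) =
      ∫⁻ y, ENNReal.ofReal (outDen Q y) * u y := by
  rw [lintegral_prod _ (by fun_prop)]
  simp_rw [lintegral_gaussianReal_add hu]
  rw [lintegral_lintegral_swap (by fun_prop)]
  congr with y
  rw [lintegral_mul_const _ (by fun_prop), outDen,
    ofReal_integral_eq_lintegral_ofReal (integrable_stdNormalPdf_sub y)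
      (ae_of_all _ fun x => (stdNormalPdf_pos _).le)]

lemma lintegral_outDen : ∫⁻ y, ENNReal.ofReal (outDen Q y) = 1 := by
  simpa using (lintegral_prod_gaussianReal_add (Q := Q) (u := fun _ => 1) measurable_const).symm

/-- Gibbs' inequality for the output density. -/
lemma integral_log_le_integral_log_outDen (hQ : ∀ᵐ x ∂Q, x ∈ Set.Icc (-A) A) {g : ℝ → ℝ}
    (hg : Measurable g) (hpos : ∀ y, 0 < g y) (hle : ∫⁻ y, ENNReal.ofReal (g y) ≤ 1) {K : ℝ}
    (hK : ∀ y, |log (g y)| ≤ K + y ^ 2) :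
    ∫ x, ∫ z, log (g (x + z)) ∂(gaussianReal 0 1) ∂Q ≤
      ∫ x, ∫ z, log (outDen Q (x + z)) ∂(gaussianReal 0 1) ∂Q := by
  have hf : Measurable (outDen Q) := continuous_outDen.measurable
  have ig := integrable_comp_add_prod_gaussianReal hQ (u := fun y => log (g y))
    (by fun_prop) hK
  have io := integrable_comp_add_prod_gaussianReal hQ (u := fun y => log (outDen Q y))
    (by fun_prop) (abs_log_outDen_le hQ)
  rw [← integral_prod _ ig, ← integral_prod _ io]
  have hlog : ∀ p : ℝ × ℝ, log (g (p.1 + p.2) / outDen Q (p.1 + p.2)) =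
      log (g (p.1 + p.2)) - log (outDen Q (p.1 + p.2)) := fun p =>
    log_div (hpos _).ne' (outDen_pos hQ _).ne'
  have key := integral_log_nonpos_of_lintegral_le_one (μ := Q.prod (gaussianReal 0 1))
    (r := fun p => g (p.1 + p.2) / outDen Q (p.1 + p.2)) (by fun_prop)
    (fun p => div_pos (hpos _) (outDen_pos hQ _)) ?_ ?_
  · simp_rw [hlog] at key
    rw [integral_sub ig io] at key
    linarith
  · rw [lintegral_prod_gaussianReal_add (u := fun y => ENNReal.ofReal (g y / outDen Q y))
      (by fun_prop)]
    refine le_trans (le_of_eq (lintegral_congr fun y => ?_)) hle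
    rw [← ENNReal.ofReal_mul (outDen_pos hQ y).le, mul_div_cancel₀ _ (outDen_pos hQ y).ne']
  · simp_rw [hlog]
    exact ig.sub io

lemma integral_log_stdNormalPdf :
    ∫ z, log (stdNormalPdf z) ∂(gaussianReal 0 1) = -(1 / 2 * log (2 * π * exp 1)) := by
  simp_rw [log_stdNormalPdf]
  rw [integral_sub (integrable_const _) (integrable_sq_gaussianReal.div_const 2), integral_div,
    integral_sq_gaussianReal, log_mul (by positivity) (by positivity), log_exp,
    log_sqrt (by positivity)]
  simp
  ring

lemma integral_mul_log_div_outDen (hQ : ∀ᵐ x ∂Q, x ∈ Set.Icc (-A) A) (x : ℝ) :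
    ∫ y, stdNormalPdf (y - x) * log (stdNormalPdf (y - x) / outDen Q y) =
      -(1 / 2 * log (2 * π * exp 1)) - ∫ z, log (outDen Q (x + z)) ∂(gaussianReal 0 1) := by
  have := integral_stdNormalPdf_sub_mul (fun y => log (stdNormalPdf (y - x) / outDen Q y)) x
  rw [this, ← integral_log_stdNormalPdf, ← integral_sub]
  · refine integral_congr_ae (ae_of_all _ fun z => ?_)
    simp only [add_sub_cancel_left]
    rw [log_div (stdNormalPdf_pos _).ne' (outDen_pos hQ _).ne']
  · simp_rw [log_stdNormalPdf]
    exact (integrable_const _).sub (integrable_sq_gaussianReal.div_const 2)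
  · exact integrable_comp_add_gaussianReal (u := fun y => log (outDen Q y))
      (continuous_outDen.measurable.log) (abs_log_outDen_le hQ) x

lemma integrable_integral_log_outDen {P : Measure ℝ} [IsProbabilityMeasure P]
    (hQ : ∀ᵐ x ∂Q, x ∈ Set.Icc (-A) A) (hP : ∀ᵐ x ∂P, x ∈ Set.Icc (-A) A) :
    Integrable (fun x => ∫ z, log (outDen P (x + z)) ∂(gaussianReal 0 1)) Q :=
  (integrable_comp_add_prod_gaussianReal hQ (u := fun y => log (outDen P y))
    (continuous_outDen.measurable.log) (abs_log_outDen_le hP)).integral_prod_left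

lemma awgnMI_eq (hQ : ∀ᵐ x ∂Q, x ∈ Set.Icc (-A) A) :
    awgnMI Q = -(1 / 2 * log (2 * π * exp 1)) -
      ∫ x, ∫ z, log (outDen Q (x + z)) ∂(gaussianReal 0 1) ∂Q := by
  unfold awgnMI
  simp_rw [integral_mul_log_div_outDen hQ]
  rw [integral_sub (integrable_const _) (integrable_integral_log_outDen hQ hQ)]
  simp

end OutputDensity

/-- The mixture of `P` with a point mass at `x₀`, with weight `t` on the point mass. -/
noncomputable def diracMixture (P : Measure ℝ) (x₀ t : ℝ) : Measure ℝ :=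
  ENNReal.ofReal (1 - t) • P + ENNReal.ofReal t • Measure.dirac x₀

lemma ae_diracMixture {P : Measure ℝ} {x₀ : ℝ} {s : Set ℝ} (hs : MeasurableSet s)
    (hP : ∀ᵐ x ∂P, x ∈ s)
    (hx₀ : x₀ ∈ s) (t : ℝ) : ∀ᵐ x ∂(diracMixture P x₀ t), x ∈ s := by
  rw [diracMixture, ae_add_measure_iff]
  exact ⟨Measure.ae_smul_measure hP _,
    Measure.ae_smul_measure ((ae_dirac_iff hs).2 hx₀) _⟩

lemma integral_diracMixture {P : Measure ℝ} (x₀ : ℝ) {t : ℝ} (h0 : 0 ≤ t) (h1 : t ≤ 1) {F : ℝ → ℝ}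
    (hF : Integrable F P) :
    ∫ x, F x ∂(diracMixture P x₀ t) = (1 - t) * ∫ x, F x ∂P + t * F x₀ := by
  have hd : Integrable F (Measure.dirac x₀) := integrable_dirac (by simp)
  rw [diracMixture, integral_add_measure (hF.smul_measure ENNReal.ofReal_ne_top)
    (hd.smul_measure ENNReal.ofReal_ne_top), integral_smul_measure, integral_smul_measure,
    integral_dirac, ENNReal.toReal_ofReal (sub_nonneg.2 h1), ENNReal.toReal_ofReal h0]
  simp

lemma stdNormalPdf_add_sub (y h x : ℝ) :
    stdNormalPdf (y + h - x) =
      exp (-h ^ 2 / 2) * (stdNormalPdf (y - x) * exp (-(h * (y - x)))) := by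
  unfold stdNormalPdf
  rw [mul_left_comm, mul_assoc, ← exp_add, ← exp_add]
  ring_nf

lemma outDen_add (P : Measure ℝ) (y h : ℝ) :
    outDen P (y + h) =
      exp (-h ^ 2 / 2) * ∫ x, stdNormalPdf (y - x) * exp (-(h * (y - x))) ∂P := by
  unfold outDen
  simp_rw [stdNormalPdf_add_sub, integral_const_mul]

lemma one_add_sq_div_two_le_cosh (x : ℝ) : 1 + x ^ 2 / 2 ≤ cosh x := by
  have h : (x / 2) ^ 2 ≤ sinh (x / 2) ^ 2 := by
    rcases le_total 0 x with hx | hx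
    · exact pow_le_pow_left₀ (by linarith) (self_le_sinh_iff.2 (by linarith)) 2
    · have := sinh_le_self_iff.2 (by linarith : x / 2 ≤ 0)
      nlinarith
  have h2 := cosh_two_mul (x / 2)
  rw [mul_div_cancel₀ x (two_ne_zero (α := ℝ)), cosh_sq] at h2
  linarith

section Capacity

variable {A : ℝ} {P : Measure ℝ} [IsProbabilityMeasure P]

lemma Continuous.integrable_of_ae_mem_Icc {F : ℝ → ℝ} (hF : Continuous F)
    (hP : ∀ᵐ x ∂P, x ∈ Set.Icc (-A) A) : Integrable F P := by
  have := hF.integrableOn_Icc (a := -A) (b := A) (μ := P)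
  rwa [IntegrableOn, Measure.restrict_eq_self_of_ae_mem hP] at this

lemma isProbabilityMeasure_diracMixture (x₀ : ℝ) {t : ℝ} (h0 : 0 ≤ t) (h1 : t ≤ 1) :
    IsProbabilityMeasure (diracMixture P x₀ t) := by
  constructor
  simp [diracMixture, ← ENNReal.ofReal_add (sub_nonneg.2 h1) h0]

lemma outDen_diracMixture (x₀ : ℝ) {t : ℝ} (h0 : 0 ≤ t) (h1 : t ≤ 1) (y : ℝ) :
    outDen (diracMixture P x₀ t) y = (1 - t) * outDen P y + t * stdNormalPdf (y - x₀) :=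
  integral_diracMixture x₀ h0 h1 (integrable_stdNormalPdf_sub y)

/-- The Karush-Kuhn-Tucker inequality for a capacity-achieving input. -/
lemma integral_log_outDen_le_of_optimal (hP : ∀ᵐ x ∂P, x ∈ Set.Icc (-A) A)
    (hopt : ∀ Q : Measure ℝ, IsProbabilityMeasure Q → (∀ᵐ x ∂Q, x ∈ Set.Icc (-A) A) →
      awgnMI Q ≤ awgnMI P) {x₀ : ℝ} (hx₀ : x₀ ∈ Set.Icc (-A) A) :
    ∫ x, ∫ z, log (outDen P (x + z)) ∂(gaussianReal 0 1) ∂P ≤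
      ∫ z, log (outDen P (x₀ + z)) ∂(gaussianReal 0 1) := by
  set a := ∫ x, ∫ z, log (outDen P (x + z)) ∂(gaussianReal 0 1) ∂P with ha
  have step : ∀ t : ℝ, 0 < t → t < 1 →
      a ≤ ∫ z, log (outDen (diracMixture P x₀ t) (x₀ + z)) ∂(gaussianReal 0 1) := by
    intro t h0 h1
    have := isProbabilityMeasure_diracMixture (P := P) x₀ h0.le h1.le
    have hQ := ae_diracMixture measurableSet_Icc hP hx₀ t
    have h := hopt _ this hQ
    rw [awgnMI_eq hP, awgnMI_eq hQ,
      integral_diracMixture x₀ h0.le h1.le (integrable_integral_log_outDen hP hQ)] at h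
    have hg := integral_log_le_integral_log_outDen hP
      (continuous_outDen (Q := diracMixture P x₀ t)).measurable (outDen_pos hQ)
      lintegral_outDen.le (abs_log_outDen_le hQ)
    rw [← ha] at hg h
    have h2 := mul_le_mul_of_nonneg_left hg (sub_nonneg.2 h1.le)
    refine le_of_mul_le_mul_left ?_ h0
    linarith
  let t : ℕ → ℝ := fun n => 1 / ((n : ℝ) + 2)
  have ht0 : ∀ n, 0 < t n := fun n => by positivity
  have ht1 : ∀ n, t n < 1 := fun n => by
    rw [div_lt_one (by positivity)]
    linarith [n.cast_nonneg (α := ℝ)]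
  have hlim : Filter.Tendsto t Filter.atTop (nhds 0) :=
    tendsto_const_nhds.div_atTop (Filter.tendsto_atTop_add_const_right _ _
      tendsto_natCast_atTop_atTop)
  refine ge_of_tendsto' (f := fun n => ∫ z, log (outDen (diracMixture P x₀ (t n)) (x₀ + z))
    ∂(gaussianReal 0 1)) (x := Filter.atTop) ?_ fun n => step (t n) (ht0 n) (ht1 n)
  refine tendsto_integral_of_dominated_convergence
    (fun z => (log √(2 * π) + A ^ 2) + (x₀ + z) ^ 2) (fun n => ?_) ?_ (fun n => ?_)
    (ae_of_all _ fun z => ?_)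
  · have := isProbabilityMeasure_diracMixture (P := P) x₀ (ht0 n).le (ht1 n).le
    exact (Measurable.log (continuous_outDen.measurable.comp
      (measurable_const_add x₀))).aestronglyMeasurable
  · have h := integrable_comp_add_gaussianReal (u := fun y => (log √(2 * π) + A ^ 2) + y ^ 2)
      (K := log √(2 * π) + A ^ 2) (by fun_prop) (fun y => ?_) x₀
    · exact h
    · rw [abs_of_nonneg]
      have := log_sqrt_two_pi_nonneg
      positivity
  · have := isProbabilityMeasure_diracMixture (P := P) x₀ (ht0 n).le (ht1 n).le
    exact ae_of_all _ fun z =>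
      abs_log_outDen_le (ae_diracMixture measurableSet_Icc hP hx₀ (t n)) _
  · refine Filter.Tendsto.log ?_ (outDen_pos hP _).ne'
    simp_rw [fun n => outDen_diracMixture (P := P) x₀ (ht0 n).le (ht1 n).le (x₀ + z)]
    have h := ((tendsto_const_nhds (x := (1 : ℝ))).sub hlim).mul_const (outDen P (x₀ + z))
    have h' := h.add (hlim.mul_const (stdNormalPdf (x₀ + z - x₀)))
    simpa using h'

/-- The Karush-Kuhn-Tucker equality for a capacity-achieving input. -/
lemma ae_integral_log_outDen_eq_of_optimal (hP : ∀ᵐ x ∂P, x ∈ Set.Icc (-A) A)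
    (hopt : ∀ Q : Measure ℝ, IsProbabilityMeasure Q → (∀ᵐ x ∂Q, x ∈ Set.Icc (-A) A) →
      awgnMI Q ≤ awgnMI P) :
    ∀ᵐ x₀ ∂P, ∫ z, log (outDen P (x₀ + z)) ∂(gaussianReal 0 1) =
      ∫ x, ∫ z, log (outDen P (x + z)) ∂(gaussianReal 0 1) ∂P := by
  have hi := integrable_integral_log_outDen hP hP
  set a := ∫ x, ∫ z, log (outDen P (x + z)) ∂(gaussianReal 0 1) ∂P with ha
  have h0 : 0 ≤ᵐ[P] fun x => (∫ z, log (outDen P (x + z)) ∂(gaussianReal 0 1)) - a := by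
    filter_upwards [hP] with x hx
    exact sub_nonneg.2 (integral_log_outDen_le_of_optimal hP hopt hx)
  have h1 := (integral_eq_zero_iff_of_nonneg_ae h0 (hi.sub (integrable_const a))).1
    (by rw [integral_sub hi (integrable_const a)]; simp [← ha])
  filter_upwards [h1] with x hx
  exact sub_eq_zero.1 hx

lemma exists_forall_outDen_le (hA : 0 ≤ A) (hP : ∀ᵐ x ∂P, x ∈ Set.Icc (-A) A) :
    ∃ y₀, ∀ y, outDen P y ≤ outDen P y₀ := by
  obtain ⟨y₀, -, hy₀⟩ := isCompact_Icc.exists_isMaxOn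
    (Set.nonempty_Icc.2 (by linarith : -A ≤ A)) (continuous_outDen (Q := P)).continuousOn
  refine ⟨y₀, fun y => ?_⟩
  have hmem : max (-A) (min y A) ∈ Set.Icc (-A) A :=
    ⟨le_max_left _ _, max_le (by linarith) (min_le_right _ _)⟩
  refine le_trans ?_ (hy₀ hmem)
  refine integral_mono_ae (integrable_stdNormalPdf_sub _) (integrable_stdNormalPdf_sub _) ?_
  filter_upwards [hP] with x hx
  unfold stdNormalPdf
  have : (max (-A) (min y A) - x) ^ 2 ≤ (y - x) ^ 2 := by
    rw [sq_le_sq]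
    obtain ⟨hx1, hx2⟩ := hx
    rcases lt_or_ge y (-A) with h | h
    · rw [min_eq_left (by linarith), max_eq_left h.le, abs_of_nonpos (by linarith),
        abs_of_nonpos (by linarith)]
      linarith
    rcases lt_or_ge A y with h' | h'
    · rw [min_eq_right h'.le, max_eq_right (by linarith), abs_of_nonneg (by linarith),
        abs_of_nonneg (by linarith)]
      linarith
    · rw [min_eq_left h', max_eq_right h]
  gcongr

lemma le_outDen_add (hP : ∀ᵐ x ∂P, x ∈ Set.Icc (-A) A) (y h : ℝ) :
    exp (-h ^ 2 / 2) * (outDen P y - h * ∫ x, stdNormalPdf (y - x) * (y - x) ∂P) ≤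
      outDen P (y + h) := by
  rw [outDen_add, outDen, ← integral_const_mul, ← integral_sub
    (Continuous.integrable_of_ae_mem_Icc (by fun_prop) hP)
    (Continuous.integrable_of_ae_mem_Icc (by fun_prop) hP)]
  refine mul_le_mul_of_nonneg_left (integral_mono
    (Continuous.integrable_of_ae_mem_Icc (by fun_prop) hP)
    (Continuous.integrable_of_ae_mem_Icc (by fun_prop) hP) fun x => ?_) (exp_pos _).le
  have := mul_le_mul_of_nonneg_left (add_one_le_exp (-(h * (y - x))))
    (stdNormalPdf_pos (y - x)).le
  simp only
  linarith

lemma integral_stdNormalPdf_mul_eq_zero_of_isMax (hP : ∀ᵐ x ∂P, x ∈ Set.Icc (-A) A) {y₀ : ℝ}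
    (hy₀ : ∀ y, outDen P y ≤ outDen P y₀) :
    ∫ x, stdNormalPdf (y₀ - x) * (y₀ - x) ∂P = 0 := by
  set m := ∫ x, stdNormalPdf (y₀ - x) * (y₀ - x) ∂P with hm
  set M := outDen P y₀ with hM
  have hMpos : 0 < M := outDen_pos hP y₀
  by_contra hne
  have hm2 : 0 < m ^ 2 := by positivity
  set δ := 1 / (M + m ^ 2 + 1) with hδ
  have hδ0 : 0 < δ := by positivity
  have hδ1 : δ * (M + m ^ 2 + 1) = 1 := by rw [hδ]; field_simp
  have h := (le_outDen_add hP y₀ (-(δ * m))).trans (hy₀ _)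
  rw [← hm, ← hM] at h
  have he := mul_le_mul_of_nonneg_right (add_one_le_exp (-(-(δ * m)) ^ 2 / 2))
    (by nlinarith : 0 ≤ M - -(δ * m) * m)
  have h1 : δ * m ^ 2 * 1 ≤ δ * m ^ 2 * (δ * M / 2 + δ * (δ * m ^ 2) / 2) := by nlinarith
  have h2 := le_of_mul_le_mul_left h1 (by positivity)
  have h3 : δ * M ≤ 1 := by nlinarith
  have h4 : δ * m ^ 2 < 1 := by nlinarith
  have h5 : δ * (δ * m ^ 2) < 1 := by nlinarith
  linarith

/-- At a maximizer, the output density dominates a Gaussian bump of unit variance. -/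
lemma log_outDen_ge_of_isMax (hP : ∀ᵐ x ∂P, x ∈ Set.Icc (-A) A) {y₀ : ℝ}
    (hy₀ : ∀ y, outDen P y ≤ outDen P y₀) (y : ℝ) :
    log (outDen P y₀) - (y - y₀) ^ 2 / 2 ≤ log (outDen P y) := by
  have h := le_outDen_add hP y₀ (y - y₀)
  rw [integral_stdNormalPdf_mul_eq_zero_of_isMax hP hy₀, mul_zero, sub_zero,
    add_sub_cancel] at h
  have hpos := outDen_pos hP y₀
  have h' := log_le_log (by positivity) h
  rw [log_mul (by positivity) hpos.ne', log_exp] at h'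
  linarith

lemma integral_stdNormalPdf_mul_sq_le_of_isMax (hP : ∀ᵐ x ∂P, x ∈ Set.Icc (-A) A) {y₀ : ℝ}
    (hy₀ : ∀ y, outDen P y ≤ outDen P y₀) :
    ∫ x, stdNormalPdf (y₀ - x) * (y₀ - x) ^ 2 ∂P ≤ outDen P y₀ := by
  set m := ∫ x, stdNormalPdf (y₀ - x) * (y₀ - x) ^ 2 ∂P with hm
  set M := outDen P y₀ with hM
  have hMpos : 0 < M := outDen_pos hP y₀
  have key : ∀ h : ℝ, exp (-h ^ 2 / 2) * (2 * M + h ^ 2 * m) ≤ 2 * M := by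
    intro h
    have h1 := hy₀ (y₀ + h)
    have h2 := hy₀ (y₀ + -h)
    rw [outDen_add P] at h1 h2
    rw [neg_sq] at h2
    have h3 : 2 * M + h ^ 2 * m ≤ ∫ x, stdNormalPdf (y₀ - x) * exp (-(h * (y₀ - x))) ∂P +
        ∫ x, stdNormalPdf (y₀ - x) * exp (-(-h * (y₀ - x))) ∂P := by
      rw [hM, hm, outDen, ← integral_const_mul, ← integral_const_mul,
        ← integral_add (Continuous.integrable_of_ae_mem_Icc (by fun_prop) hP)
          (Continuous.integrable_of_ae_mem_Icc (by fun_prop) hP),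
        ← integral_add (Continuous.integrable_of_ae_mem_Icc (by fun_prop) hP)
          (Continuous.integrable_of_ae_mem_Icc (by fun_prop) hP)]
      refine integral_mono (Continuous.integrable_of_ae_mem_Icc (by fun_prop) hP)
        (Continuous.integrable_of_ae_mem_Icc (by fun_prop) hP) fun x => ?_
      have hc := one_add_sq_div_two_le_cosh (h * (y₀ - x))
      rw [cosh_eq] at hc
      have := mul_le_mul_of_nonneg_left hc (stdNormalPdf_pos (y₀ - x)).le
      simp only [neg_mul, neg_neg]
      linarith
    have := mul_le_mul_of_nonneg_left h3 (exp_pos (-h ^ 2 / 2)).le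
    linarith
  refine le_of_forall_pos_le_add fun ε hε => ?_
  set s := min 1 (ε / M) with hs
  have hs0 : 0 < s := by positivity
  have h := key √(2 * s)
  rw [sq_sqrt (by positivity), ← le_div_iff₀' (exp_pos _), div_eq_mul_inv, ← exp_neg] at h
  have he := (abs_le.1 (abs_exp_sub_one_sub_id_le
    (x := s) (by rw [abs_of_pos hs0]; exact min_le_left _ _))).2
  have h1 : -(-(2 * s) / 2) = s := by ring
  rw [h1] at h
  have h2 : s * m ≤ s * (M + M * s) := by nlinarith
  have h3 := le_of_mul_le_mul_left h2 hs0
  have h4 : M * s ≤ ε := by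
    rw [← le_div_iff₀' hMpos]; exact min_le_right _ _
  linarith

/-- The maximum of the optimal output density is at most `exp (1 - h(Y))`. -/
lemma log_outDen_le_of_optimal (hP : ∀ᵐ x ∂P, x ∈ Set.Icc (-A) A)
    (hopt : ∀ Q : Measure ℝ, IsProbabilityMeasure Q → (∀ᵐ x ∂Q, x ∈ Set.Icc (-A) A) →
      awgnMI Q ≤ awgnMI P) {y₀ : ℝ} (hy₀ : ∀ y, outDen P y ≤ outDen P y₀) :
    log (outDen P y₀) ≤
      (∫ x, ∫ z, log (outDen P (x + z)) ∂(gaussianReal 0 1) ∂P) + 1 := by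
  have hkkt := ae_integral_log_outDen_eq_of_optimal hP hopt
  set a := ∫ x, ∫ z, log (outDen P (x + z)) ∂(gaussianReal 0 1) ∂P with ha
  set M := outDen P y₀ with hM
  have hMpos : 0 < M := outDen_pos hP y₀
  have hx : ∀ x, log M - (1 + (y₀ - x) ^ 2) / 2 ≤
      ∫ z, log (outDen P (x + z)) ∂(gaussianReal 0 1) := by
    intro x
    have h1 : ∫ z, (log M - ((y₀ - x) ^ 2 / 2 - (y₀ - x) * z + z ^ 2 / 2)) ∂(gaussianReal 0 1) =
        log M - (1 + (y₀ - x) ^ 2) / 2 := by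
      have i1 := integrable_id_gaussianReal.const_mul (y₀ - x)
      have i2 := integrable_sq_gaussianReal.div_const 2
      have i3 : Integrable (fun z => (y₀ - x) ^ 2 / 2 - (y₀ - x) * z) (gaussianReal 0 1) :=
        (integrable_const _).sub i1
      rw [integral_sub (integrable_const _) (by exact i3.add i2), integral_add i3 i2,
        integral_sub (integrable_const _) i1, integral_const_mul, integral_div, integral_div,
        integral_sq_gaussianReal, ProbabilityTheory.integral_id_gaussianReal]
      simp
      ring
    rw [← h1]
    refine integral_mono ?_ (integrable_comp_add_gaussianReal (u := fun y => log (outDen P y))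
      (continuous_outDen.measurable.log) (abs_log_outDen_le hP) x) fun z => ?_
    · exact (integrable_const _).sub (((integrable_const _).sub
        (integrable_id_gaussianReal.const_mul (y₀ - x))).add
        (integrable_sq_gaussianReal.div_const 2))
    · have := log_outDen_ge_of_isMax hP hy₀ (x + z)
      simp only
      nlinarith
  have h2 : ∫ x, stdNormalPdf (y₀ - x) * (log M - a) ∂P ≤
      ∫ x, (1 / 2 * stdNormalPdf (y₀ - x) + 1 / 2 * (stdNormalPdf (y₀ - x) * (y₀ - x) ^ 2)) ∂P := by
    refine integral_mono_ae (Continuous.integrable_of_ae_mem_Icc (by fun_prop) hP)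
      (Continuous.integrable_of_ae_mem_Icc (by fun_prop) hP) ?_
    filter_upwards [hkkt] with x hxa
    have h3 := hx x
    rw [hxa] at h3
    have := mul_le_mul_of_nonneg_left h3 (stdNormalPdf_pos (y₀ - x)).le
    linarith
  rw [integral_add (Continuous.integrable_of_ae_mem_Icc (by fun_prop) hP)
      (Continuous.integrable_of_ae_mem_Icc (by fun_prop) hP), integral_const_mul,
      integral_const_mul, integral_mul_const] at h2
  have h4 := integral_stdNormalPdf_mul_sq_le_of_isMax hP hy₀
  rw [← hM] at h4
  change M * (log M - a) ≤ 1 / 2 * M + _ at h2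
  have h5 : M * (log M - a) ≤ M * 1 := by linarith
  linarith [le_of_mul_le_mul_left h5 hMpos]

end Capacity

section UpperBound

lemma integrable_mul_stdNormalPdf {u : ℝ → ℝ} (hu : Integrable u (gaussianReal 0 1)) :
    Integrable (fun z => u z * stdNormalPdf z) := by
  rw [gaussianReal_of_var_ne_zero _ one_ne_zero,
    integrable_withDensity_iff (measurable_gaussianPDF 0 1)
      (ae_of_all _ fun _ => gaussianPDF_lt_top)] at hu
  simpa [toReal_gaussianPDF, gaussianPDFReal_zero_one_eq_stdNormalPdf] using hu

lemma hasDerivAt_stdNormalPdf (z : ℝ) : HasDerivAt stdNormalPdf (-z * stdNormalPdf z) z := by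
  have h : HasDerivAt (fun t : ℝ => -t ^ 2 / 2) (-z) z := by
    refine (((hasDerivAt_pow 2 z).neg).div_const 2).congr_deriv ?_
    push_cast
    ring
  refine ((h.exp).const_mul (√(2 * π))⁻¹).congr_deriv ?_
  rw [stdNormalPdf]
  ring

/-- The function `1 - w ^ 2` cut off to the positive half-line. -/
noncomputable def posOneSubSq (w : ℝ) : ℝ := if 0 < w then 1 - w ^ 2 else 0

lemma measurable_posOneSubSq : Measurable posOneSubSq :=
  Measurable.ite measurableSet_Ioi (by fun_prop) measurable_const

lemma abs_posOneSubSq_sub_le {A : ℝ} (hA : 0 ≤ A) (w : ℝ) :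
    |posOneSubSq (w - A)| ≤ 1 + w ^ 2 := by
  unfold posOneSubSq
  split_ifs with h
  · rw [abs_le]
    constructor <;> nlinarith
  · rw [abs_zero]
    positivity

lemma integral_posOneSubSq_sub_nonneg {t : ℝ} (ht : 0 ≤ t) :
    0 ≤ ∫ z, posOneSubSq (z - t) ∂(gaussianReal 0 1) := by
  have i1 : Integrable (fun z : ℝ => (z - t) * stdNormalPdf z) :=
    integrable_mul_stdNormalPdf (integrable_id_gaussianReal.sub (integrable_const t))
  have i2 : Integrable (fun z : ℝ => (1 - z ^ 2 + t * z) * stdNormalPdf z) :=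
    integrable_mul_stdNormalPdf (((integrable_const 1).sub integrable_sq_gaussianReal).add
      (integrable_id_gaussianReal.const_mul t))
  have i3 : Integrable (fun z : ℝ => (1 - t ^ 2 - z ^ 2 + 2 * t * z) * stdNormalPdf z) :=
    integrable_mul_stdNormalPdf (((integrable_const (1 - t ^ 2)).sub
      integrable_sq_gaussianReal).add (integrable_id_gaussianReal.const_mul (2 * t)))
  have hderiv : ∀ z : ℝ, HasDerivAt (fun z => (z - t) * stdNormalPdf z)
      ((1 - z ^ 2 + t * z) * stdNormalPdf z) z := by
    intro z
    refine (((hasDerivAt_id z).sub_const t).mul (hasDerivAt_stdNormalPdf z)).congr_deriv ?_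
    rw [id]
    ring
  have hlim := tendsto_zero_of_hasDerivAt_of_integrableOn_Ioi (a := t)
    (fun z _ => hderiv z) i2.integrableOn i1.integrableOn
  have h0 := integral_Ioi_of_hasDerivAt_of_tendsto (a := t)
    (hderiv t).continuousAt.continuousWithinAt (fun z _ => hderiv z) i2.integrableOn hlim
  rw [sub_self, zero_mul, sub_zero] at h0
  rw [integral_gaussianReal_eq_integral_smul one_ne_zero]
  have heq : (fun z => gaussianPDFReal 0 1 z • posOneSubSq (z - t)) =
      (Set.Ioi t).indicator fun z => (1 - t ^ 2 - z ^ 2 + 2 * t * z) * stdNormalPdf z := by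
    ext z
    rw [gaussianPDFReal_zero_one_eq_stdNormalPdf, posOneSubSq, Set.indicator]
    simp only [sub_pos, Set.mem_Ioi, smul_eq_mul]
    split_ifs
    · ring
    · simp
  rw [heq, integral_indicator measurableSet_Ioi, ← h0]
  refine setIntegral_mono_on i2.integrableOn i3.integrableOn measurableSet_Ioi fun z hz => ?_
  refine mul_le_mul_of_nonneg_right ?_ (stdNormalPdf_pos z).le
  nlinarith [Set.mem_Ioi.1 hz]

lemma integral_comp_neg_gaussianReal {u : ℝ → ℝ} :
    ∫ z, u (-z) ∂(gaussianReal 0 1) = ∫ z, u z ∂(gaussianReal 0 1) := by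
  conv_rhs => rw [← neg_zero, ← gaussianReal_map_neg]
  exact ((MeasurableEquiv.neg ℝ).measurableEmbedding.integral_map u).symm

/-- A probability density that is constant on `[-A, A]` with Gaussian tails outside. -/
noncomputable def flatGaussianDensity (A y : ℝ) : ℝ :=
  (2 * A + √(2 * π * exp 1))⁻¹ *
    exp ((posOneSubSq (y - A) + posOneSubSq (-A - y)) / 2)

lemma abs_log_flatGaussianDensity_le {A : ℝ} (hA : 0 < A) (y : ℝ) :
    |log (flatGaussianDensity A y)| ≤
      (|log (2 * A + √(2 * π * exp 1))| + 1) + y ^ 2 := by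
  have h2 := abs_posOneSubSq_sub_le hA.le y
  have h3 := abs_posOneSubSq_sub_le hA.le (-y)
  rw [neg_sq, sub_eq_add_neg, add_comm, ← sub_eq_add_neg] at h3
  rw [flatGaussianDensity, log_mul (by positivity) (by positivity), log_exp, log_inv]
  rw [abs_le] at *
  have h4 := neg_abs_le (log (2 * A + √(2 * π * exp 1)))
  have h5 := le_abs_self (log (2 * A + √(2 * π * exp 1)))
  constructor <;> linarith

lemma lintegral_flatGaussianDensity_le {A : ℝ} (hA : 0 < A) :
    ∫⁻ y, ENNReal.ofReal (flatGaussianDensity A y) ≤ 1 := by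
  set a := (2 * A + √(2 * π * exp 1))⁻¹ with ha
  have ha0 : 0 < a := by positivity
  let k : ℝ → ℝ := (Set.Ioi 0).indicator fun w => exp (-(1 / 2) * w ^ 2)
  have hkint : Integrable k :=
    (integrable_exp_neg_mul_sq (by norm_num : (0 : ℝ) < 1 / 2)).indicator measurableSet_Ioi
  have hk : ∫ w, k w = √(2 * π) / 2 := by
    rw [integral_indicator measurableSet_Ioi, integral_gaussian_Ioi]
    congr 2
    ring
  let b : ℝ → ℝ := (Set.Icc (-A) A).indicator fun _ => 1
  have hb : ∫ y, b y = 2 * A := by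
    rw [integral_indicator measurableSet_Icc]
    simp only [integral_const, measureReal_restrict_apply_univ, volume_real_Icc, smul_eq_mul]
    rw [max_eq_left (by linarith)]
    ring
  have hbint : Integrable b := (integrableOn_const (by simp)).integrable_indicator measurableSet_Icc
  have i1 : Integrable fun y => k (y - A) := hkint.comp_sub_right A
  have i2 : Integrable fun y => k (-A - y) := hkint.comp_sub_left (-A)
  have iG : Integrable fun y => a * (b y + (exp (1 / 2) * k (y - A) + exp (1 / 2) * k (-A - y))) :=
    (hbint.add ((i1.const_mul _).add (i2.const_mul _))).const_mul a
  have hle : ∀ y, flatGaussianDensity A y ≤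
      a * (b y + (exp (1 / 2) * k (y - A) + exp (1 / 2) * k (-A - y))) := by
    intro y
    refine mul_le_mul_of_nonneg_left ?_ ha0.le
    simp only [posOneSubSq, k, b, Set.indicator, Set.mem_Ioi, Set.mem_Icc]
    by_cases h1 : 0 < y - A
    · rw [if_pos h1, if_neg (by linarith), if_neg (by intro h; linarith [h.2]), if_pos h1,
        if_neg (by linarith), ← exp_add]
      simp only [zero_add, mul_zero, add_zero]
      apply le_of_eq
      ring_nf
    by_cases h2 : 0 < -A - y
    · rw [if_neg h1, if_pos h2, if_neg (by intro h; linarith [h.1]), if_neg h1, if_pos h2,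
        ← exp_add]
      simp only [zero_add, mul_zero]
      apply le_of_eq
      ring_nf
    · rw [if_neg h1, if_neg h2, if_pos ⟨by linarith, by linarith⟩, if_neg h1, if_neg h2]
      simp
  have h_int : ∫ y, a * (b y + (exp (1 / 2) * k (y - A) + exp (1 / 2) * k (-A - y))) = 1 := by
    rw [integral_const_mul,
      integral_add hbint (by exact (i1.const_mul _).add (i2.const_mul _)),
      integral_add (i1.const_mul _) (i2.const_mul _), integral_const_mul, integral_const_mul,
      integral_sub_right_eq_self k, integral_sub_left_eq_self k, hk, hb, ha,
      sqrt_mul (by positivity) (exp 1), ← exp_half]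
    have : 2 * A + √(2 * π) * exp (1 / 2) ≠ 0 := by positivity
    field_simp
    ring
  calc ∫⁻ y, ENNReal.ofReal (flatGaussianDensity A y)
      ≤ ∫⁻ y, ENNReal.ofReal
          (a * (b y + (exp (1 / 2) * k (y - A) + exp (1 / 2) * k (-A - y)))) :=
        lintegral_mono fun y => ENNReal.ofReal_le_ofReal (hle y)
    _ = 1 := by
      rw [← ofReal_integral_eq_lintegral_ofReal iG (ae_of_all _ fun y =>
        le_trans (by unfold flatGaussianDensity; positivity) (hle y)), h_int, ENNReal.ofReal_one]

lemma measurable_flatGaussianDensity (A : ℝ) : Measurable (flatGaussianDensity A) := by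
  have := measurable_posOneSubSq
  unfold flatGaussianDensity
  fun_prop

lemma neg_log_le_integral_log_flatGaussianDensity {A x : ℝ} (hA : 0 < A)
    (hx : x ∈ Set.Icc (-A) A) :
    -log (2 * A + √(2 * π * exp 1)) ≤
      ∫ z, log (flatGaussianDensity A (x + z)) ∂(gaussianReal 0 1) := by
  have hψ : ∀ w, |posOneSubSq w| ≤ 1 + w ^ 2 := fun w => by
    simpa using abs_posOneSubSq_sub_le le_rfl w
  have hi : ∀ t, Integrable (fun z => posOneSubSq (z - t)) (gaussianReal 0 1) := by
    intro t
    have := integrable_comp_add_gaussianReal measurable_posOneSubSq hψ (-t)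
    simpa only [neg_add_eq_sub] using this
  have h1 := integral_posOneSubSq_sub_nonneg (t := A - x) (by linarith [hx.2])
  have h2 := integral_posOneSubSq_sub_nonneg (t := A + x) (by linarith [hx.1])
  have i2 : Integrable (fun z => posOneSubSq (-z - (A + x))) (gaussianReal 0 1) := by
    have := integrable_comp_add_gaussianReal (u := fun z => posOneSubSq (-z))
      (measurable_posOneSubSq.comp measurable_neg) (fun w => by simpa using hψ (-w)) (A + x)
    refine this.congr (ae_of_all _ fun z => ?_)
    simp only
    ring_nf
  rw [← integral_comp_neg_gaussianReal] at h2
  have heq : ∀ z, log (flatGaussianDensity A (x + z)) = -log (2 * A + √(2 * π * exp 1)) +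
      (posOneSubSq (z - (A - x)) + posOneSubSq (-z - (A + x))) / 2 := by
    intro z
    rw [flatGaussianDensity, log_mul (by positivity) (by positivity), log_exp, log_inv]
    ring_nf
  simp_rw [heq]
  rw [integral_add (integrable_const _) (by exact ((hi _).add i2).div_const 2), integral_div,
    integral_add (hi _) i2]
  simp only [integral_const, probReal_univ, one_smul]
  linarith

/-- McKellips' upper bound on the mutual information. -/
lemma neg_log_le_integral_log_outDen {A : ℝ} (hA : 0 < A) {Q : Measure ℝ}
    [IsProbabilityMeasure Q] (hQ : ∀ᵐ x ∂Q, x ∈ Set.Icc (-A) A) :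
    -log (2 * A + √(2 * π * exp 1)) ≤
      ∫ x, ∫ z, log (outDen Q (x + z)) ∂(gaussianReal 0 1) ∂Q := by
  have hm := measurable_flatGaussianDensity A
  refine le_trans ?_ (integral_log_le_integral_log_outDen hQ hm
    (fun y => by unfold flatGaussianDensity; positivity)
    (lintegral_flatGaussianDensity_le hA) (abs_log_flatGaussianDensity_le hA))
  have h := integral_mono_ae (μ := Q) (integrable_const (-log (2 * A + √(2 * π * exp 1))))
    (integrable_comp_add_prod_gaussianReal hQ
      (u := fun y => log (flatGaussianDensity A y)) hm.log
      (abs_log_flatGaussianDensity_le hA)).integral_prod_left ?_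
  · simpa using h
  filter_upwards [hQ] with x hx
  exact neg_log_le_integral_log_flatGaussianDensity hA hx

end UpperBound

section LowerBound

/-- The map `x ↦ 2 A ∫₀ˣ φ`, which transports the standard normal law into `[-A, A]`. -/
noncomputable def gaussianToIcc (A x : ℝ) : ℝ := 2 * A * ∫ t in (0)..x, stdNormalPdf t

lemma hasDerivAt_gaussianToIcc (A x : ℝ) :
    HasDerivAt (gaussianToIcc A) (2 * A * stdNormalPdf x) x :=
  (continuous_stdNormalPdf.integral_hasStrictDerivAt 0 x).hasDerivAt.const_mul (2 * A)

@[fun_prop]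
lemma continuous_gaussianToIcc (A : ℝ) : Continuous (gaussianToIcc A) :=
  continuous_iff_continuousAt.2 fun x => (hasDerivAt_gaussianToIcc A x).continuousAt

lemma integrable_stdNormalPdf : Integrable stdNormalPdf := by
  simpa using integrable_mul_stdNormalPdf (integrable_const 1)

lemma integral_stdNormalPdf : ∫ t, stdNormalPdf t = 1 := by
  simpa [gaussianPDFReal_zero_one_eq_stdNormalPdf] using
    integral_gaussianPDFReal_eq_one 0 (v := 1) one_ne_zero

lemma abs_gaussianToIcc_le {A : ℝ} (hA : 0 ≤ A) (x : ℝ) : |gaussianToIcc A x| ≤ A := by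
  have hneg : ∫ t in (-x)..0, stdNormalPdf t = ∫ t in (0)..x, stdNormalPdf t := by
    have := intervalIntegral.integral_comp_neg (a := 0) (b := x) stdNormalPdf
    simpa [stdNormalPdf_neg] using this.symm
  have hadd := intervalIntegral.integral_add_adjacent_intervals (μ := volume)
    (continuous_stdNormalPdf.intervalIntegrable (-x) 0)
    (continuous_stdNormalPdf.intervalIntegrable 0 x)
  have heq : gaussianToIcc A x = A * ∫ t in (-x)..x, stdNormalPdf t := by
    rw [← hadd, hneg, gaussianToIcc]
    ring
  have hle : |∫ t in (-x)..x, stdNormalPdf t| ≤ 1 := by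
    rw [← norm_eq_abs]
    refine (intervalIntegral.norm_integral_le_integral_norm_uIoc).trans ?_
    rw [← integral_stdNormalPdf]
    simp_rw [norm_of_nonneg (stdNormalPdf_pos _).le]
    exact setIntegral_le_integral integrable_stdNormalPdf
      (ae_of_all _ fun t => (stdNormalPdf_pos t).le)
  rw [heq, abs_mul, abs_of_nonneg hA]
  exact mul_le_of_le_one_right hA hle

lemma measurePreserving_rotation_gaussianReal (θ : ℝ) :
    MeasurePreserving (fun p : ℝ × ℝ => (cos θ * p.1 + sin θ * p.2, -sin θ * p.1 + cos θ * p.2))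
      ((gaussianReal 0 1).prod (gaussianReal 0 1)) ((gaussianReal 0 1).prod (gaussianReal 0 1)) := by
  refine ⟨by fun_prop, ?_⟩
  exact IsGaussian.map_rotation_eq_self (μ := gaussianReal 0 1) (by simp) θ

variable {A : ℝ}

lemma lintegral_comp_mul_deriv_le {f : ℝ → ENNReal} {F F' : ℝ → ℝ}
    (hF : ∀ x, HasDerivAt F (F' x) x) (hF' : ∀ x, 0 < F' x) :
    ∫⁻ x, ENNReal.ofReal (F' x) * f (F x) ≤ ∫⁻ y, f y := by
  have hmono : StrictMono F := strictMono_of_hasDerivAt_pos hF hF'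
  have h := lintegral_image_eq_lintegral_abs_deriv_mul MeasurableSet.univ
    (fun x _ => (hF x).hasDerivWithinAt) hmono.injective.injOn f
  simp_rw [abs_of_pos (hF' _), Measure.restrict_univ] at h
  rw [← h]
  exact setLIntegral_le_lintegral _ _

lemma lintegral_transport_le_one (hA : 0 < A) {θ : ℝ} (hc : 0 < cos θ) (hs : 0 < sin θ)
    {f : ℝ → ℝ} (hf : Measurable f)
    (hf1 : ∫⁻ y, ENNReal.ofReal (f y) ≤ 1) :
    ∫⁻ p, ENNReal.ofReal (f (gaussianToIcc A p.1 + p.2) *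
        (cos θ * (2 * A * stdNormalPdf p.1) + sin θ) /
        stdNormalPdf (cos θ * p.1 + sin θ * p.2))
      ∂((gaussianReal 0 1).prod (gaussianReal 0 1)) ≤ 1 := by
  have hmeas : Measurable fun p : ℝ × ℝ => ENNReal.ofReal (f (gaussianToIcc A p.1 + p.2) *
        (cos θ * (2 * A * stdNormalPdf p.1) + sin θ) /
        stdNormalPdf (cos θ * p.1 + sin θ * p.2)) := by
    have h1 : Measurable (gaussianToIcc A) := (continuous_gaussianToIcc A).measurable
    have h2 := continuous_stdNormalPdf.measurable
    fun_prop
  have hrot := measurePreserving_rotation_gaussianReal (-θ)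
  rw [← hrot.lintegral_comp hmeas]
  rw [lintegral_prod_symm _ (by exact (hmeas.comp hrot.measurable).aemeasurable)]
  simp only [cos_neg, sin_neg, neg_neg]
  have hinner : ∀ u : ℝ, ∫⁻ x, ENNReal.ofReal (f (gaussianToIcc A (cos θ * x + -sin θ * u) +
        (sin θ * x + cos θ * u)) *
        (cos θ * (2 * A * stdNormalPdf (cos θ * x + -sin θ * u)) + sin θ) /
        stdNormalPdf (cos θ * (cos θ * x + -sin θ * u) + sin θ * (sin θ * x + cos θ * u)))
        ∂(gaussianReal 0 1) ≤ 1 := by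
    intro u
    have hx : ∀ x, cos θ * (cos θ * x + -sin θ * u) + sin θ * (sin θ * x + cos θ * u) = x := by
      intro x
      linear_combination x * cos_sq_add_sin_sq θ
    simp_rw [hx]
    have hd : ∀ x, HasDerivAt (fun x => gaussianToIcc A (cos θ * x + -sin θ * u) +
        (sin θ * x + cos θ * u))
        (cos θ * (2 * A * stdNormalPdf (cos θ * x + -sin θ * u)) + sin θ) x := by
      intro x
      have h1 : HasDerivAt (fun x => cos θ * x + -sin θ * u) (cos θ) x := by
        simpa using ((hasDerivAt_id x).const_mul (cos θ)).add_const (-sin θ * u)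
      have h2 : HasDerivAt (fun x => sin θ * x + cos θ * u) (sin θ) x := by
        simpa using ((hasDerivAt_id x).const_mul (sin θ)).add_const (cos θ * u)
      refine (((hasDerivAt_gaussianToIcc A _).comp x h1).add h2).congr_deriv ?_
      ring
    have hpos : ∀ x, 0 < cos θ * (2 * A * stdNormalPdf (cos θ * x + -sin θ * u)) + sin θ := by
      intro x
      have := stdNormalPdf_pos (cos θ * x + -sin θ * u)
      positivity
    rw [lintegral_gaussianReal_eq]
    · refine le_trans (le_of_eq (lintegral_congr fun x => ?_))
        ((lintegral_comp_mul_deriv_le (f := fun y => ENNReal.ofReal (f y)) hd hpos).trans hf1)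
      rw [← ENNReal.ofReal_mul (stdNormalPdf_pos x).le, ← ENNReal.ofReal_mul (hpos x).le,
        mul_div_cancel₀ _ (stdNormalPdf_pos x).ne', mul_comm]
    · have h1 : Measurable (gaussianToIcc A) := (continuous_gaussianToIcc A).measurable
      have h2 := continuous_stdNormalPdf.measurable
      fun_prop
  calc _ ≤ ∫⁻ _, 1 ∂(gaussianReal 0 1) := lintegral_mono hinner
    _ = 1 := by simp

lemma isProbabilityMeasure_map_gaussianToIcc (A : ℝ) :
    IsProbabilityMeasure ((gaussianReal 0 1).map (gaussianToIcc A)) :=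
  Measure.isProbabilityMeasure_map (continuous_gaussianToIcc A).aemeasurable

lemma ae_map_gaussianToIcc (hA : 0 < A) :
    ∀ᵐ x ∂((gaussianReal 0 1).map (gaussianToIcc A)), x ∈ Set.Icc (-A) A := by
  refine (ae_map_iff (continuous_gaussianToIcc A).aemeasurable
    (p := fun x => x ∈ Set.Icc (-A) A) measurableSet_Icc).2 ?_
  exact ae_of_all _ fun x => abs_le.1 (abs_gaussianToIcc_le hA.le x)

/-- A weighted form of the entropy power inequality for a uniform plus a standard normal. -/
lemma integral_log_outDen_map_gaussianToIcc_le (hA : 0 < A) {θ : ℝ} (hc : 0 < cos θ)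
    (hs : 0 < sin θ) :
    ∫ x, ∫ z, log (outDen ((gaussianReal 0 1).map (gaussianToIcc A)) (x + z)) ∂(gaussianReal 0 1)
        ∂((gaussianReal 0 1).map (gaussianToIcc A)) ≤
      -(sin θ ^ 2 * (1 / 2 * log (2 * π * exp 1) - log (sin θ)) +
        cos θ ^ 2 * (log (2 * A) - log (cos θ))) := by
  have hQp := isProbabilityMeasure_map_gaussianToIcc A
  have hQ := ae_map_gaussianToIcc hA
  set Q := (gaussianReal 0 1).map (gaussianToIcc A) with hQdef
  set γ := gaussianReal 0 1 with hγ
  have hT : Measurable (gaussianToIcc A) := (continuous_gaussianToIcc A).measurable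
  have hφ := continuous_stdNormalPdf.measurable
  have hfm : Measurable (outDen Q) := continuous_outDen.measurable
  have hrot := measurePreserving_rotation_gaussianReal θ
  have hD0 : ∀ x, 0 < cos θ * (2 * A * stdNormalPdf x) + sin θ := fun x => by
    have := stdNormalPdf_pos x
    positivity
  have i1 : Integrable (fun p : ℝ × ℝ => log (outDen Q (gaussianToIcc A p.1 + p.2)))
      (γ.prod γ) := by
    have h := integrable_comp_add_prod_gaussianReal hQ (u := fun y => log (outDen Q y))
      hfm.log (abs_log_outDen_le hQ)
    have hmp : MeasurePreserving (Prod.map (gaussianToIcc A) id) (γ.prod γ) (Q.prod γ) :=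
      MeasurePreserving.prod ⟨hT, rfl⟩ (MeasurePreserving.id γ)
    exact hmp.integrable_comp_of_integrable h
  have i2 : Integrable (fun x => log (cos θ * (2 * A * stdNormalPdf x) + sin θ)) γ := by
    refine Integrable.mono' (integrable_const
      (|log (sin θ)| + |log (cos θ * (2 * A * (√(2 * π))⁻¹) + sin θ)|))
      (Measurable.log (by fun_prop)).aestronglyMeasurable (ae_of_all _ fun x => ?_)
    have h1 : log (sin θ) ≤ log (cos θ * (2 * A * stdNormalPdf x) + sin θ) := by
      refine log_le_log hs (le_add_of_nonneg_left ?_)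
      have := stdNormalPdf_pos x
      positivity
    have h2 : log (cos θ * (2 * A * stdNormalPdf x) + sin θ) ≤
        log (cos θ * (2 * A * (√(2 * π))⁻¹) + sin θ) := by
      refine log_le_log (hD0 x) ?_
      gcongr
      exact stdNormalPdf_le x
    rw [norm_eq_abs]
    exact (abs_le_max_abs_abs h1 h2).trans (max_le_add_of_nonneg (abs_nonneg _) (abs_nonneg _))
  have i3 : Integrable (fun x => log (stdNormalPdf x)) γ := by
    simp_rw [log_stdNormalPdf]
    exact (integrable_const _).sub (integrable_sq_gaussianReal.div_const 2)
  have i4 : Integrable (fun p : ℝ × ℝ => log (stdNormalPdf (cos θ * p.1 + sin θ * p.2)))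
      (γ.prod γ) := hrot.integrable_comp_of_integrable (i3.comp_fst γ)
  have e1 : ∫ p, log (outDen Q (gaussianToIcc A p.1 + p.2)) ∂(γ.prod γ) =
      ∫ x, ∫ z, log (outDen Q (x + z)) ∂γ ∂Q := by
    rw [integral_prod _ i1, hQdef, integral_map hT.aemeasurable]
    exact (integrable_integral_log_outDen hQ hQ).aestronglyMeasurable
  have e2 : ∫ p, log (cos θ * (2 * A * stdNormalPdf p.1) + sin θ) ∂(γ.prod γ) =
      ∫ x, log (cos θ * (2 * A * stdNormalPdf x) + sin θ) ∂γ := by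
    rw [integral_prod _ (i2.comp_fst γ)]
    simp
  have e3 : ∫ p, log (stdNormalPdf (cos θ * p.1 + sin θ * p.2)) ∂(γ.prod γ) =
      -(1 / 2 * log (2 * π * exp 1)) := by
    have h := integral_map (μ := γ.prod γ) hrot.measurable.aemeasurable
      (f := fun p => log (stdNormalPdf p.1))
      (Measurable.log (hφ.comp measurable_fst)).aestronglyMeasurable
    rw [hrot.map_eq, integral_prod _ (i3.comp_fst γ)] at h
    rw [← h, ← integral_log_stdNormalPdf]
    simp [hγ]
  have e4 : cos θ ^ 2 * (log (2 * A) - 1 / 2 * log (2 * π * exp 1) - log (cos θ)) -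
      sin θ ^ 2 * log (sin θ) ≤ ∫ x, log (cos θ * (2 * A * stdNormalPdf x) + sin θ) ∂γ := by
    have h1 : ∫ x, (cos θ ^ 2 * (log (2 * A) - log (cos θ)) - sin θ ^ 2 * log (sin θ) +
        cos θ ^ 2 * log (stdNormalPdf x)) ∂γ =
        cos θ ^ 2 * (log (2 * A) - 1 / 2 * log (2 * π * exp 1) - log (cos θ)) -
          sin θ ^ 2 * log (sin θ) := by
      rw [integral_add (integrable_const _) (i3.const_mul _), integral_const_mul,
        integral_log_stdNormalPdf]
      simp
      ring
    rw [← h1]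
    refine integral_mono ((integrable_const _).add (i3.const_mul _)) i2 fun x => ?_
    have hφx := stdNormalPdf_pos x
    have hconc := strictConcaveOn_log_Ioi.concaveOn.2
      (Set.mem_Ioi.2 (by positivity : 0 < 2 * A * stdNormalPdf x / cos θ))
      (Set.mem_Ioi.2 (by positivity : 0 < 1 / sin θ)) (sq_nonneg (cos θ)) (sq_nonneg (sin θ))
      (cos_sq_add_sin_sq θ)
    simp only [smul_eq_mul] at hconc
    rw [log_div (by positivity) hc.ne', log_mul (by positivity) hφx.ne', log_div one_ne_zero hs.ne',
      log_one] at hconc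
    have harg : cos θ ^ 2 * (2 * A * stdNormalPdf x / cos θ) + sin θ ^ 2 * (1 / sin θ) =
        cos θ * (2 * A * stdNormalPdf x) + sin θ := by
      field_simp
    rw [harg] at hconc
    simp only
    linarith
  have hlog : ∀ p : ℝ × ℝ, log (outDen Q (gaussianToIcc A p.1 + p.2) *
      (cos θ * (2 * A * stdNormalPdf p.1) + sin θ) /
      stdNormalPdf (cos θ * p.1 + sin θ * p.2)) =
      log (outDen Q (gaussianToIcc A p.1 + p.2)) +
        log (cos θ * (2 * A * stdNormalPdf p.1) + sin θ) -
        log (stdNormalPdf (cos θ * p.1 + sin θ * p.2)) := fun p => by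
    rw [log_div (mul_pos (outDen_pos hQ _) (hD0 _)).ne' (stdNormalPdf_pos _).ne',
      log_mul (outDen_pos hQ _).ne' (hD0 _).ne']
  have i12 : Integrable (fun p : ℝ × ℝ => log (outDen Q (gaussianToIcc A p.1 + p.2)) +
      log (cos θ * (2 * A * stdNormalPdf p.1) + sin θ)) (γ.prod γ) := i1.add (i2.comp_fst γ)
  have key := integral_log_nonpos_of_lintegral_le_one (μ := γ.prod γ)
    (r := fun p => outDen Q (gaussianToIcc A p.1 + p.2) *
      (cos θ * (2 * A * stdNormalPdf p.1) + sin θ) /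
      stdNormalPdf (cos θ * p.1 + sin θ * p.2)) (by fun_prop)
    (fun p => div_pos (mul_pos (outDen_pos hQ _) (hD0 _)) (stdNormalPdf_pos _))
    (lintegral_transport_le_one hA hc hs hfm lintegral_outDen.le)
    (by simp_rw [hlog]; exact i12.sub i4)
  simp_rw [hlog] at key
  rw [integral_sub i12 i4, integral_add i1 (i2.comp_fst γ), e1, e2, e3] at key
  have hsc := cos_sq_add_sin_sq θ
  have : sin θ ^ 2 * (1 / 2 * log (2 * π * exp 1)) =
      1 / 2 * log (2 * π * exp 1) - cos θ ^ 2 * (1 / 2 * log (2 * π * exp 1)) := by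
    linear_combination (1 / 2 * log (2 * π * exp 1)) * hsc
  linarith

/-- The entropy power lower bound on the capacity. -/
lemma integral_log_outDen_le_neg_log_of_optimal (hA : 0 < A) {P : Measure ℝ}
    [IsProbabilityMeasure P] (hP : ∀ᵐ x ∂P, x ∈ Set.Icc (-A) A)
    (hopt : ∀ Q : Measure ℝ, IsProbabilityMeasure Q → (∀ᵐ x ∂Q, x ∈ Set.Icc (-A) A) →
      awgnMI Q ≤ awgnMI P) :
    ∫ x, ∫ z, log (outDen P (x + z)) ∂(gaussianReal 0 1) ∂P ≤
      -log √(2 * π * exp 1 + 4 * A ^ 2) := by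
  have hQp := isProbabilityMeasure_map_gaussianToIcc A
  have hQ := ae_map_gaussianToIcc hA
  have h := hopt _ hQp hQ
  rw [awgnMI_eq hP, awgnMI_eq hQ] at h
  set S := 2 * π * exp 1 + 4 * A ^ 2 with hS
  have hS0 : 0 < S := by positivity
  set θ := arccos (2 * A / √S) with hθ
  have hcos2 : (2 * A / √S) ^ 2 = 4 * A ^ 2 / S := by
    rw [div_pow, sq_sqrt hS0.le]
    ring
  have hsub : 1 - (2 * A / √S) ^ 2 = 2 * π * exp 1 / S := by
    rw [hcos2, hS]
    field_simp
    ring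
  have hc : cos θ = 2 * A / √S := by
    refine cos_arccos (by linarith [show 0 < 2 * A / √S by positivity]) ?_
    have : 0 ≤ 1 - (2 * A / √S) ^ 2 := by rw [hsub]; positivity
    nlinarith [show 0 < 2 * A / √S by positivity]
  have hs : sin θ = √(2 * π * exp 1) / √S := by
    rw [hθ, sin_arccos, hsub, sqrt_div (by positivity)]
  have hlc : log (cos θ) = log (2 * A) - log √S := by
    rw [hc, log_div (by positivity) (by positivity)]
  have hls : log (sin θ) = 1 / 2 * log (2 * π * exp 1) - log √S := by
    rw [hs, log_div (by positivity) (by positivity), log_sqrt (by positivity)]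
    ring
  have hmain := integral_log_outDen_map_gaussianToIcc_le hA (θ := θ)
    (by rw [hc]; positivity) (by rw [hs]; positivity)
  rw [hlc, hls] at hmain
  have hsc := cos_sq_add_sin_sq θ
  have : cos θ ^ 2 * (log (2 * A) - (log (2 * A) - log √S)) +
      sin θ ^ 2 * (1 / 2 * log (2 * π * exp 1) - (1 / 2 * log (2 * π * exp 1) - log √S)) =
      log √S := by
    linear_combination log √S * hsc
  linarith

end LowerBound

theorem stmt_15 (A : ℝ) (hA : 0 < A)
    (Pstar : Measure ℝ) [IsProbabilityMeasure Pstar]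
    (hsupp : ∀ᵐ x ∂Pstar, x ∈ Set.Icc (-A) A)
    (hopt : ∀ Q : Measure ℝ, IsProbabilityMeasure Q → (∀ᵐ x ∂Q, x ∈ Set.Icc (-A) A) →
      awgnMI Q ≤ awgnMI Pstar)
    (C MA hZ : ℝ) (hC : C = awgnMI Pstar) (hMA : MA = ⨆ y : ℝ, outDen Pstar y)
    (hhZ : hZ = (1 / 2) * Real.log (2 * π * Real.exp 1)) :
    1 / (Real.sqrt (2 * π * Real.exp 1) + 2 * A) ≤ Real.exp (-C - hZ) ∧
    Real.exp (-C - hZ) ≤ MA ∧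
    MA ≤ Real.exp (-C - hZ + 1) ∧
    Real.exp (-C - hZ + 1) ≤ Real.exp 1 / Real.sqrt (2 * π * Real.exp 1 + 4 * A ^ 2) := by
  have hpos := outDen_pos hsupp
  have hCh : -C - hZ = ∫ x, ∫ z, log (outDen Pstar (x + z)) ∂(gaussianReal 0 1) ∂Pstar := by
    rw [hC, hhZ, awgnMI_eq hsupp]
    ring
  obtain ⟨y₀, hy₀⟩ := exists_forall_outDen_le hA.le hsupp
  have hM : MA = outDen Pstar y₀ := by
    rw [hMA]
    exact le_antisymm (ciSup_le hy₀) (le_ciSup ⟨_, Set.forall_mem_range.2 hy₀⟩ y₀)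
  have hS : 0 < 2 * A + √(2 * π * exp 1) := by positivity
  refine ⟨?_, ?_, ?_, ?_⟩
  · rw [hCh, one_div, add_comm, ← exp_log hS, ← exp_neg]
    exact exp_le_exp.2 (neg_log_le_integral_log_outDen hA hsupp)
  · rw [hM, ← exp_log (hpos y₀), hCh]
    refine exp_le_exp.2 ?_
    have hm : Measurable fun y => log (outDen Pstar y) := continuous_outDen.measurable.log
    have hi := integrable_comp_add_prod_gaussianReal hsupp hm (abs_log_outDen_le hsupp)
    rw [← integral_prod _ hi]
    have h := integral_mono hi (integrable_const (log (outDen Pstar y₀)))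
      fun p => log_le_log (hpos _) (hy₀ (p.1 + p.2))
    simpa using h
  · rw [hM, ← exp_log (hpos y₀), hCh]
    exact exp_le_exp.2 (log_outDen_le_of_optimal hsupp hopt hy₀)
  · have hS' : 0 < √(2 * π * exp 1 + 4 * A ^ 2) := by positivity
    rw [hCh, add_comm, exp_add, div_eq_mul_inv, ← exp_log hS', ← exp_neg]
    exact mul_le_mul_of_nonneg_left
      (exp_le_exp.2 (integral_log_outDen_le_neg_log_of_optimal hA hsupp hopt)) (exp_pos 1).le
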